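/- If real matrices A_1, …, A_S ∈ ℝ^{T×V} each satisfy the orthonormality constraint A_iᵀ A_i = I_V (the V×V identity matrix), and Ḡ = (1/S) Σ_{j=1}^S A_j, then Σ_{1≤i<j≤S} ‖A_i − A_j‖_F² = S² · (V − ‖Ḡ‖_F²). Consequently, under this constraint, minimizing the pairwise hyperalignment objective is equivalent to maximizing ‖Ḡ‖_F². -/

import Mathlib

open Finset Matrix

/-- Squared Frobenius norm of a real matrix. -/
def frobSq {T V : ℕ} (A : Matrix (Fin T) (Fin V) ℝ) : ℝ :=
  ∑ m, ∑ n, (A m n) ^ 2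

theorem aux_frobSq_orth {T V : ℕ} (A : Matrix (Fin T) (Fin V) ℝ) (h : Aᵀ * A = 1) :
    frobSq A = V := by
  have h1 : (Aᵀ * A).trace = (V : ℝ) := by rw [h]; simp
  rw [← h1]
  unfold frobSq
  rw [Finset.sum_comm]
  simp [Matrix.trace, Matrix.mul_apply, pow_two]

theorem aux_half {S : ℕ} (f : Fin S → Fin S → ℝ) (hs : ∀ i j, f i j = f j i)
    (h0 : ∀ i, f i i = 0) :
    2 * ∑ i : Fin S, ∑ j ∈ Finset.univ.filter (fun j => i < j), f i j = ∑ i, ∑ j, f i j := by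
  have h1 : ∑ i : Fin S, ∑ j ∈ Finset.univ.filter (fun j => i < j), f i j
      = ∑ i : Fin S, ∑ j : Fin S, if j < i then f i j else 0 := by
    simp_rw [Finset.sum_filter]
    rw [Finset.sum_comm]
    refine Finset.sum_congr rfl fun i _ => Finset.sum_congr rfl fun j _ => ?_
    rw [hs]
  rw [two_mul]
  nth_rewrite 2 [h1]
  simp_rw [Finset.sum_filter, ← Finset.sum_add_distrib]
  refine Finset.sum_congr rfl fun i _ => Finset.sum_congr rfl fun j _ => ?_
  rcases lt_trichotomy i j with h | h | h
  · simp [h, h.not_gt]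
  · subst h; simp [h0]
  · simp [h, h.not_gt]

theorem aux_scalar {S : ℕ} (a : Fin S → ℝ) :
    ∑ i, ∑ j, (a i - a j) ^ 2 = 2 * S * ∑ i, a i ^ 2 - 2 * (∑ i, a i) ^ 2 := by
  simp_rw [sub_sq, Finset.sum_add_distrib, Finset.sum_sub_distrib, ← Finset.mul_sum,
    ← Finset.sum_mul, ← Finset.mul_sum]
  simp [← Finset.mul_sum]
  ring

theorem aux_swap {S T V : ℕ} (g : Fin S → Fin T → Fin V → ℝ) :
    ∑ i, ∑ m, ∑ n, g i m n = ∑ m, ∑ n, ∑ i, g i m n := by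
  rw [Finset.sum_comm]
  exact Finset.sum_congr rfl fun m _ => Finset.sum_comm

theorem aux_main (S T V : ℕ) (A : Fin S → Matrix (Fin T) (Fin V) ℝ)
    (hA : ∀ i, (A i)ᵀ * A i = 1) :
    ∑ i : Fin S, ∑ j ∈ Finset.univ.filter (fun j => i < j), frobSq (A i - A j)
        = (S : ℝ) ^ 2 * ((V : ℝ) - frobSq ((S : ℝ)⁻¹ • ∑ j : Fin S, A j)) := by
  have hh := aux_half (fun i j => frobSq (A i - A j))
    (fun i j => by
      unfold frobSq
      refine Finset.sum_congr rfl fun m _ => Finset.sum_congr rfl fun n _ => ?_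
      simp only [Matrix.sub_apply]; ring)
    (fun i => by simp [frobSq])
  have h2 : ∑ i, ∑ j, frobSq (A i - A j)
      = 2 * S * ∑ i, frobSq (A i) - 2 * frobSq (∑ i, A i) := by
    unfold frobSq
    rw [aux_swap (fun i m n => (A i m n) ^ 2),
      Finset.sum_congr rfl (fun i _ => aux_swap (fun j m n => ((A i - A j) m n) ^ 2)),
      aux_swap (fun i m n => ∑ j, ((A i - A j) m n) ^ 2)]
    simp_rw [Finset.mul_sum, ← Finset.sum_sub_distrib]
    refine Finset.sum_congr rfl fun m _ => Finset.sum_congr rfl fun n _ => ?_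
    have := aux_scalar (fun i => A i m n)
    simp only [Matrix.sub_apply, Matrix.sum_apply]
    rw [this, Finset.mul_sum]
  have h3 : ∑ i, frobSq (A i) = S * V := by
    simp [fun i => aux_frobSq_orth (A i) (hA i)]
  have h4 : (S : ℝ) ^ 2 * frobSq ((S : ℝ)⁻¹ • ∑ j : Fin S, A j) = frobSq (∑ j, A j) := by
    rcases Nat.eq_zero_or_pos S with h | h
    · subst h; simp [frobSq]
    · have : (S : ℝ) ≠ 0 := by positivity
      unfold frobSq
      simp_rw [Finset.mul_sum, Matrix.smul_apply, smul_eq_mul, mul_pow]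
      refine Finset.sum_congr rfl fun m _ => Finset.sum_congr rfl fun n _ => ?_
      field_simp
  rw [h3] at h2
  linarith

/-- If each `A i` satisfies the orthonormality constraint `A iᵀ A i = I`, and
`Ḡ = (1/S) Σ_j A j`, then `Σ_{i<j} ‖A i − A j‖_F² = S² (V − ‖Ḡ‖_F²)`.
Consequently, for any parametrized family satisfying the constraint, minimizing
the pairwise hyperalignment objective is equivalent to maximizing `‖Ḡ‖_F²`. -/
theorem pairwise_frobSq_of_orthonormal (S T V : ℕ)
    (A : Fin S → Matrix (Fin T) (Fin V) ℝ)
    (hA : ∀ i, (A i)ᵀ * A i = 1)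
    (G : Matrix (Fin T) (Fin V) ℝ) (hG : G = (S : ℝ)⁻¹ • ∑ j : Fin S, A j) :
    (∑ i : Fin S, ∑ j ∈ Finset.univ.filter (fun j => i < j), frobSq (A i - A j)
        = (S : ℝ) ^ 2 * ((V : ℝ) - frobSq G)) ∧
    (∀ (P : Type) (B : P → Fin S → Matrix (Fin T) (Fin V) ℝ),
      (∀ p i, (B p i)ᵀ * B p i = 1) →
      ∀ p₀ : P,
        ((∀ p, (∑ i : Fin S, ∑ j ∈ Finset.univ.filter (fun j => i < j),
                  frobSq (B p₀ i - B p₀ j))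
              ≤ ∑ i : Fin S, ∑ j ∈ Finset.univ.filter (fun j => i < j),
                  frobSq (B p i - B p j)) ↔
         (∀ p, frobSq ((S : ℝ)⁻¹ • ∑ j : Fin S, B p j)
              ≤ frobSq ((S : ℝ)⁻¹ • ∑ j : Fin S, B p₀ j)))) := by
  refine ⟨by rw [hG]; exact aux_main S T V A hA, ?_⟩
  intro P B hB p₀
  refine forall_congr' fun p => ?_
  rw [aux_main S T V _ (hB p₀), aux_main S T V _ (hB p)]
  rcases Nat.eq_zero_or_pos S with h | h
  · subst h; simp
  · have : (0 : ℝ) < (S : ℝ) ^ 2 := by positivity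
    rw [mul_le_mul_iff_right₀ this, sub_le_sub_iff_left]
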